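/- Consider the symmetric exclusion process η_t on ℤ started from a deterministic configuration η, with two-particle exclusion semigroup V₂(t) and two independent-walk semigroup U₂(t). For all t ≥ 0 and z ∈ ℝ, the negative covariance sum 𝒞_t(η,z) = -∑_{j≠k, j,k>z} Cov_η(η_t(j), η_t(k)) satisfies 𝒞_t(η,z) ≤ 2∑_{i≥1} p_i ∑_{k∈ℤ} ∫₀ᵗ (E_k[η(ξ_s)] - E_{k+i}[η(ξ_s)])² P_{k+i}(ξ_{t-s} > z)² ds, where ξ is a single random walk with jump rates {p_i}. -/

import Mathlib

open MeasureTheory Filter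
open scoped Topology ENNReal

/-- `n`-fold convolution power of a step distribution `p` on `ℤ`:
the distribution of the discrete-time walk after `n` steps. -/
noncomputable def convPow (p : ℤ → ℝ) : ℕ → ℤ → ℝ
  | 0 => fun x => if x = 0 then 1 else 0
  | n + 1 => fun x => ∑' y : ℤ, convPow p n y * p (x - y)

/-- Distribution at time `t` of the rate-1 continuous-time random walk on `ℤ`
started at `0` with step distribution `p`: `ξ_t = S_{N_t}` with `N` a rate-1
Poisson process independent of the discrete walk `S`. -/
noncomputable def ctPMF (p : ℤ → ℝ) (t : ℝ) (x : ℤ) : ℝ :=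
  ∑' n : ℕ, (Real.exp (-t) * t ^ n / n.factorial) * convPow p n x

/-- `P_0(ξ_t > z)`. -/
noncomputable def ctTailGt (p : ℤ → ℝ) (t z : ℝ) : ℝ :=
  ∑' x : ℤ, if z < (x : ℝ) then ctPMF p t x else 0

/-- `P_0(ξ_t ≥ z)`. -/
noncomputable def ctTailGe (p : ℤ → ℝ) (t z : ℝ) : ℝ :=
  ∑' x : ℤ, if z ≤ (x : ℝ) then ctPMF p t x else 0

/-- One-particle exclusion (= random walk) semigroup applied to a profile `η`:
by duality, `E_η[η_t(k)] = E_k[η(ξ_t)] = ∑_y P₀(ξ_t = y - k) η(y)`. -/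
noncomputable def oneP (p : ℤ → ℝ) (η : ℤ → ℝ) (s : ℝ) (k : ℤ) : ℝ :=
  ∑' y : ℤ, ctPMF p s (y - k) * η y

/-- Generator `𝒱` of two exclusion particles on `ℤ` with symmetric rates `p`. -/
noncomputable def twoGen (p : ℤ → ℝ) (f : ℤ → ℤ → ℝ) (x y : ℤ) : ℝ :=
  (∑' z : ℤ, if z ≠ y then p (z - x) * (f z y - f x y) else 0)
    + ∑' z : ℤ, if z ≠ x then p (z - y) * (f x z - f x y) else 0

section Convolution

variable {p : ℤ → ℝ}

/-- The shear `(x, y) ↦ (y, x - y)` of `ℤ × ℤ`. -/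
def convShear : ℤ × ℤ ≃ ℤ × ℤ where
  toFun q := (q.2, q.1 - q.2)
  invFun q := (q.1 + q.2, q.1)
  left_inv q := by ext <;> simp
  right_inv q := by ext <;> simp

theorem hasSum_exp_conv {a b : ℤ → ℝ} (ha : ∀ x, 0 ≤ a x) (hb : ∀ x, 0 ≤ b x) {θ α β : ℝ}
    (hα : HasSum (fun x : ℤ => Real.exp (θ * x) * a x) α)
    (hβ : HasSum (fun x : ℤ => Real.exp (θ * x) * b x) β) :
    HasSum (fun x : ℤ => Real.exp (θ * x) * ∑' y : ℤ, a y * b (x - y)) (α * β) := by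
  have h1 := hα.summable.mul_of_nonneg hβ.summable
    (fun x => mul_nonneg (Real.exp_pos _).le (ha x)) (fun x => mul_nonneg (Real.exp_pos _).le (hb x))
  have h2 := hα.mul hβ h1
  have h3 := convShear.hasSum_iff.mpr h2
  refine h3.prod_fiberwise fun x => ?_
  rw [← tsum_mul_left]
  refine (h3.summable.prod_factor x).hasSum_iff.mpr (tsum_congr fun y => ?_)
  simp only [convShear, Equiv.coe_fn_mk, Function.comp]
  rw [show θ * (x : ℝ) = θ * (y : ℝ) + θ * ((x - y : ℤ) : ℝ) by push_cast; ring, Real.exp_add]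
  ring

theorem convPow_nonneg (hp0 : ∀ i, 0 ≤ p i) (n : ℕ) (x : ℤ) : 0 ≤ convPow p n x := by
  induction n generalizing x with
  | zero => simp only [convPow]; split_ifs <;> norm_num
  | succ n ih => exact tsum_nonneg fun y => mul_nonneg (ih y) (hp0 _)

theorem hasSum_exp_convPow (hp0 : ∀ i, 0 ≤ p i) {θ M : ℝ}
    (hM : HasSum (fun x : ℤ => Real.exp (θ * x) * p x) M) (n : ℕ) :
    HasSum (fun x : ℤ => Real.exp (θ * x) * convPow p n x) (M ^ n) := by
  induction n with
  | zero =>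
    convert hasSum_ite_eq (0 : ℤ) (1 : ℝ) using 1
    · ext x
      by_cases hx : x = 0 <;> simp [convPow, hx]
    · simp
  | succ n ih => exact hasSum_exp_conv (convPow_nonneg hp0 n) hp0 ih hM

theorem hasSum_convPow (hp0 : ∀ i, 0 ≤ p i) (hp1 : HasSum p 1) (n : ℕ) :
    HasSum (convPow p n) 1 := by
  simpa using hasSum_exp_convPow (θ := 0) (M := 1) hp0 (by simpa using hp1) n

theorem convPow_le_one (hp0 : ∀ i, 0 ≤ p i) (hp1 : HasSum p 1) (n : ℕ) (x : ℤ) :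
    convPow p n x ≤ 1 :=
  le_hasSum (hasSum_convPow hp0 hp1 n) x fun y _ => convPow_nonneg hp0 n y

theorem ctPMF_nonneg (hp0 : ∀ i, 0 ≤ p i) {t : ℝ} (ht : 0 ≤ t) (x : ℤ) : 0 ≤ ctPMF p t x :=
  tsum_nonneg fun n => mul_nonneg (by positivity) (convPow_nonneg hp0 n x)

theorem summable_exp_mul_pow_div_factorial (t : ℝ) :
    Summable fun n : ℕ => Real.exp (-t) * t ^ n / n.factorial := by
  simpa only [mul_div_assoc] using (Real.summable_pow_div_factorial t).mul_left _

theorem summable_ctPMF_series (hp0 : ∀ i, 0 ≤ p i) (hp1 : HasSum p 1) (t : ℝ) (x : ℤ) :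
    Summable fun n : ℕ => (Real.exp (-t) * t ^ n / n.factorial) * convPow p n x := by
  refine (summable_exp_mul_pow_div_factorial t).abs.of_norm_bounded fun n => ?_
  rw [norm_mul, Real.norm_eq_abs, Real.norm_of_nonneg (convPow_nonneg hp0 n x)]
  exact mul_le_of_le_one_right (abs_nonneg _) (convPow_le_one hp0 hp1 n x)

/-- The law at time `t` of the walk has all the exponential moments of the step distribution. -/
theorem summable_exp_ctPMF (hp0 : ∀ i, 0 ≤ p i) {θ : ℝ}
    (hM : Summable fun x : ℤ => Real.exp (θ * x) * p x) {t : ℝ} (ht : 0 ≤ t) :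
    Summable fun x : ℤ => Real.exp (θ * x) * ctPMF p t x := by
  obtain ⟨M, hM⟩ := hM
  have h1 : Summable fun q : ℕ × ℤ => (Real.exp (-t) * t ^ q.1 / q.1.factorial) *
      (Real.exp (θ * q.2) * convPow p q.1 q.2) := by
    refine (summable_prod_of_nonneg fun q => mul_nonneg (by positivity)
      (mul_nonneg (Real.exp_pos _).le (convPow_nonneg hp0 _ _))).mpr ⟨fun n => ?_, ?_⟩
    · exact (hasSum_exp_convPow hp0 hM n).summable.mul_left (Real.exp (-t) * t ^ n / n.factorial)
    · simp only [tsum_mul_left, (hasSum_exp_convPow hp0 hM _).tsum_eq]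
      refine ((Real.summable_pow_div_factorial (t * M)).mul_left (Real.exp (-t))).congr fun n => ?_
      rw [mul_pow]; ring
  refine h1.prod_symm.prod.congr fun x => ?_
  rw [ctPMF, ← tsum_mul_left]
  exact tsum_congr fun n => by simp only [Prod.swap]; ring

theorem summable_ctPMF (hp0 : ∀ i, 0 ≤ p i) (hp1 : HasSum p 1) {t : ℝ} (ht : 0 ≤ t) :
    Summable (ctPMF p t) := by
  simpa using summable_exp_ctPMF (θ := 0) hp0 (by simpa using hp1.summable) ht

theorem ctPMF_le_of_le (hp0 : ∀ i, 0 ≤ p i) (hp1 : HasSum p 1) {r t : ℝ} (hr : 0 ≤ r)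
    (hrt : r ≤ t) (x : ℤ) : ctPMF p r x ≤ Real.exp t * ctPMF p t x := by
  rw [ctPMF, ctPMF, ← tsum_mul_left]
  refine (summable_ctPMF_series hp0 hp1 r x).tsum_le_tsum (fun n => ?_)
    ((summable_ctPMF_series hp0 hp1 t x).mul_left _)
  rw [← mul_assoc]
  refine mul_le_mul_of_nonneg_right ?_ (convPow_nonneg hp0 n x)
  rw [← mul_div_assoc, ← mul_assoc, ← Real.exp_add, add_neg_cancel, Real.exp_zero]
  gcongr
  exact Real.exp_le_one_iff.mpr (neg_nonpos.mpr hr)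

end Convolution

section OneParticle

theorem hasDerivAt_tsum_pow_div_factorial_mul {c : ℕ → ℝ} (hc : ∀ n, |c n| ≤ 1) (t : ℝ) :
    HasDerivAt (fun s : ℝ => ∑' n : ℕ, s ^ n / n.factorial * c n)
      (∑' n : ℕ, t ^ n / n.factorial * c (n + 1)) t := by
  have hstep : ∀ (n : ℕ) (s : ℝ),
      ((n + 1 : ℕ) : ℝ) * s ^ (n + 1 - 1) / (n + 1).factorial = s ^ n / n.factorial := by
    intro n s
    rw [Nat.factorial_succ, Nat.add_sub_cancel]
    push_cast
    field_simp
  have hu : Summable fun n : ℕ => (n : ℝ) * (|t| + 1) ^ (n - 1) / n.factorial := by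
    rw [← summable_nat_add_iff 1]
    simpa only [hstep] using Real.summable_pow_div_factorial (|t| + 1)
  have hb : ∀ (n : ℕ), ∀ s ∈ Metric.ball (0 : ℝ) (|t| + 1),
      ‖(n : ℝ) * s ^ (n - 1) / n.factorial * c n‖ ≤ (n : ℝ) * (|t| + 1) ^ (n - 1) / n.factorial := by
    intro n s hs
    rw [mem_ball_zero_iff] at hs
    rw [norm_mul, norm_div, norm_mul, norm_pow, Real.norm_natCast, Real.norm_natCast,
      Real.norm_eq_abs (c n)]
    refine (mul_le_of_le_one_right (by positivity) (hc n)).trans ?_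
    gcongr
  have ht : t ∈ Metric.ball (0 : ℝ) (|t| + 1) := by simp
  have h0 : Summable fun n : ℕ => t ^ n / n.factorial * c n := by
    refine (Real.summable_pow_div_factorial t).abs.of_norm_bounded fun n => ?_
    rw [norm_mul]
    exact mul_le_of_le_one_right (abs_nonneg _) (hc n)
  have key := hasDerivAt_tsum_of_isPreconnected hu Metric.isOpen_ball
    (convex_ball _ _).isPreconnected
    (g := fun (n : ℕ) s => s ^ n / n.factorial * c n)
    (fun (n : ℕ) s _ => ((hasDerivAt_pow n s).div_const (n.factorial : ℝ)).mul_const (c n))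
    hb ht h0 ht
  refine key.congr_deriv ?_
  have hs : Summable fun n : ℕ => (n : ℝ) * t ^ (n - 1) / n.factorial * c n :=
    hu.of_norm_bounded fun n => hb n t ht
  rw [hs.tsum_eq_zero_add]
  simp only [hstep]
  simp

variable {p f : ℤ → ℝ}

theorem summable_shift_mul {a : ℤ → ℝ} (ha : Summable a) (ha0 : ∀ x, 0 ≤ a x)
    (hf : ∀ y, |f y| ≤ 1) (k : ℤ) : Summable fun y => a (y - k) * f y := by
  refine ((Equiv.subRight k).summable_iff.mpr ha).of_norm_bounded fun y => ?_
  rw [norm_mul, Real.norm_of_nonneg (ha0 _)]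
  exact mul_le_of_le_one_right (ha0 _) (hf y)

theorem hasSum_shift {a : ℤ → ℝ} {s : ℝ} (ha : HasSum a s) (k : ℤ) :
    HasSum (fun y => a (y - k)) s :=
  (Equiv.subRight k).hasSum_iff.mpr ha

theorem hasSum_shift_left {a : ℤ → ℝ} {s : ℝ} (ha : HasSum a s) (k : ℤ) :
    HasSum (fun y => a (k - y)) s :=
  (Equiv.subLeft k).hasSum_iff.mpr ha

theorem abs_tsum_shift_mul_le {a : ℤ → ℝ} (ha : HasSum a 1) (ha0 : ∀ x, 0 ≤ a x)
    (hf : ∀ y, |f y| ≤ 1) (k : ℤ) : |∑' y, a (y - k) * f y| ≤ 1 := by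
  rw [← Real.norm_eq_abs]
  refine tsum_of_norm_bounded (hasSum_shift ha k) fun y => ?_
  rw [norm_mul, Real.norm_of_nonneg (ha0 _)]
  exact mul_le_of_le_one_right (ha0 _) (hf y)

/-- The profile `f` averaged over `n` steps of the discrete walk started at `k`. -/
noncomputable def convAvg (p f : ℤ → ℝ) (n : ℕ) (k : ℤ) : ℝ :=
  ∑' y : ℤ, convPow p n (y - k) * f y

theorem abs_convAvg_le (hp0 : ∀ i, 0 ≤ p i) (hp1 : HasSum p 1) (hf : ∀ y, |f y| ≤ 1)
    (n : ℕ) (k : ℤ) : |convAvg p f n k| ≤ 1 :=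
  abs_tsum_shift_mul_le (hasSum_convPow hp0 hp1 n) (convPow_nonneg hp0 n) hf k

theorem convAvg_succ (hp0 : ∀ i, 0 ≤ p i) (hp1 : HasSum p 1) (hf : ∀ y, |f y| ≤ 1)
    (n : ℕ) (k : ℤ) : convAvg p f (n + 1) k = ∑' z : ℤ, p (z - k) * convAvg p f n z := by
  have hs : Summable fun q : ℤ × ℤ => p (q.1 - k) * (convPow p n (q.2 - q.1) * f q.2) := by
    have h0 : Summable fun q : ℤ × ℤ => p (q.1 - k) * convPow p n (q.2 - q.1) := by
      refine (summable_prod_of_nonneg fun q => mul_nonneg (hp0 _) (convPow_nonneg hp0 n _)).mpr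
        ⟨fun z => ((hasSum_shift (hasSum_convPow hp0 hp1 n) z).summable.mul_left (p (z - k))), ?_⟩
      simp only [tsum_mul_left, (hasSum_shift (hasSum_convPow hp0 hp1 n) _).tsum_eq, mul_one]
      exact (hasSum_shift hp1 k).summable
    refine h0.of_norm_bounded fun q => ?_
    rw [← mul_assoc, norm_mul, Real.norm_of_nonneg (mul_nonneg (hp0 _) (convPow_nonneg hp0 n _))]
    exact mul_le_of_le_one_right (mul_nonneg (hp0 _) (convPow_nonneg hp0 n _)) (hf _)
  simp only [convAvg, ← tsum_mul_left]
  rw [← hs.tsum_comm]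
  refine tsum_congr fun y => ?_
  rw [convPow, ← tsum_mul_right, ← (Equiv.subLeft y).tsum_eq]
  refine tsum_congr fun z => ?_
  simp only [Equiv.subLeft_apply]
  rw [show y - k - (y - z) = z - k by ring]
  ring

theorem oneP_eq_tsum_convAvg (hp0 : ∀ i, 0 ≤ p i) (hp1 : HasSum p 1) (hf : ∀ y, |f y| ≤ 1)
    (t : ℝ) (k : ℤ) :
    oneP p f t k = ∑' n : ℕ, Real.exp (-t) * t ^ n / n.factorial * convAvg p f n k := by
  have hs : Summable fun q : ℕ × ℤ =>
      Real.exp (-t) * t ^ q.1 / q.1.factorial * (convPow p q.1 (q.2 - k) * f q.2) := by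
    have h0 : Summable fun q : ℕ × ℤ =>
        |Real.exp (-t) * t ^ q.1 / q.1.factorial| * convPow p q.1 (q.2 - k) := by
      refine (summable_prod_of_nonneg fun q =>
        mul_nonneg (abs_nonneg _) (convPow_nonneg hp0 _ _)).mpr ⟨fun n =>
          ((hasSum_shift (hasSum_convPow hp0 hp1 n) k).summable.mul_left
            |Real.exp (-t) * t ^ n / n.factorial|), ?_⟩
      simp only [tsum_mul_left, (hasSum_shift (hasSum_convPow hp0 hp1 _) _).tsum_eq, mul_one]
      exact (summable_exp_mul_pow_div_factorial t).abs
    refine h0.of_norm_bounded fun q => ?_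
    rw [norm_mul, norm_mul, Real.norm_eq_abs, Real.norm_of_nonneg (convPow_nonneg hp0 _ _)]
    exact mul_le_mul_of_nonneg_left (mul_le_of_le_one_right (convPow_nonneg hp0 _ _) (hf _))
      (abs_nonneg _)
  simp only [convAvg, ← tsum_mul_left]
  rw [← hs.tsum_comm]
  refine tsum_congr fun y => ?_
  rw [ctPMF, ← tsum_mul_right]
  exact tsum_congr fun n => by ring

theorem tsum_mul_oneP (hp0 : ∀ i, 0 ≤ p i) (hp1 : HasSum p 1) (hf : ∀ y, |f y| ≤ 1)
    (t : ℝ) (k : ℤ) :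
    ∑' z : ℤ, p (z - k) * oneP p f t z =
      ∑' n : ℕ, Real.exp (-t) * t ^ n / n.factorial * convAvg p f (n + 1) k := by
  have hs : Summable fun q : ℕ × ℤ =>
      Real.exp (-t) * t ^ q.1 / q.1.factorial * (p (q.2 - k) * convAvg p f q.1 q.2) := by
    have h0 := (summable_exp_mul_pow_div_factorial t).abs.mul_of_nonneg
      (hasSum_shift hp1 k).summable (fun _ => abs_nonneg _) (fun _ => hp0 _)
    refine h0.of_norm_bounded fun q => ?_
    rw [norm_mul, norm_mul, Real.norm_eq_abs, Real.norm_of_nonneg (hp0 _)]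
    exact mul_le_mul_of_nonneg_left
      (mul_le_of_le_one_right (hp0 _) (abs_convAvg_le hp0 hp1 hf _ _)) (abs_nonneg _)
  simp only [convAvg_succ hp0 hp1 hf, ← tsum_mul_left, oneP_eq_tsum_convAvg hp0 hp1 hf]
  refine Eq.trans ?_ hs.tsum_comm
  exact tsum_congr fun z => tsum_congr fun n => by ring

/-- The backward equation for the random walk semigroup. -/
theorem hasDerivAt_oneP (hp0 : ∀ i, 0 ≤ p i) (hp1 : HasSum p 1) (hf : ∀ y, |f y| ≤ 1)
    (k : ℤ) (t : ℝ) :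
    HasDerivAt (fun s => oneP p f s k) (∑' z : ℤ, p (z - k) * oneP p f t z - oneP p f t k) t := by
  have hdiv : ∀ (c : ℕ → ℝ) (s : ℝ), ∑' n : ℕ, Real.exp (-s) * s ^ n / n.factorial * c n =
      Real.exp (-s) * ∑' n : ℕ, s ^ n / n.factorial * c n := by
    intro c s
    rw [← tsum_mul_left]
    exact tsum_congr fun n => by ring
  rw [tsum_mul_oneP hp0 hp1 hf, hdiv]
  simp only [oneP_eq_tsum_convAvg hp0 hp1 hf, hdiv]
  refine (((hasDerivAt_neg t).exp).mul (hasDerivAt_tsum_pow_div_factorial_mul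
    (fun n => abs_convAvg_le hp0 hp1 hf n k) t)).congr_deriv ?_
  ring

theorem continuous_oneP (hp0 : ∀ i, 0 ≤ p i) (hp1 : HasSum p 1) (hf : ∀ y, |f y| ≤ 1)
    (k : ℤ) : Continuous fun s => oneP p f s k :=
  continuous_iff_continuousAt.mpr fun t => (hasDerivAt_oneP hp0 hp1 hf k t).continuousAt

theorem oneP_nonneg (hp0 : ∀ i, 0 ≤ p i) (hf : ∀ y, 0 ≤ f y) {t : ℝ} (ht : 0 ≤ t) (k : ℤ) :
    0 ≤ oneP p f t k :=
  tsum_nonneg fun y => mul_nonneg (ctPMF_nonneg hp0 ht _) (hf y)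

theorem oneP_mono (hp0 : ∀ i, 0 ≤ p i) (hp1 : HasSum p 1) {g : ℤ → ℝ} (hf : ∀ y, |f y| ≤ 1)
    (hg : ∀ y, |g y| ≤ 1) (hfg : ∀ y, f y ≤ g y) {t : ℝ} (ht : 0 ≤ t) (k : ℤ) :
    oneP p f t k ≤ oneP p g t k :=
  (summable_shift_mul (summable_ctPMF hp0 hp1 ht) (ctPMF_nonneg hp0 ht) hf k).tsum_le_tsum
    (fun y => mul_le_mul_of_nonneg_left (hfg y) (ctPMF_nonneg hp0 ht _))
    (summable_shift_mul (summable_ctPMF hp0 hp1 ht) (ctPMF_nonneg hp0 ht) hg k)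

theorem abs_oneP_le (hp0 : ∀ i, 0 ≤ p i) (hp1 : HasSum p 1) (hf : ∀ y, |f y| ≤ 1)
    {t : ℝ} (ht : 0 ≤ t) (k : ℤ) : |oneP p f t k| ≤ 1 := by
  have h1 : HasSum (fun n : ℕ => Real.exp (-t) * t ^ n / n.factorial) 1 := by
    have := (NormedSpace.expSeries_div_hasSum_exp t).mul_left (Real.exp (-t))
    rw [← Real.exp_eq_exp_ℝ, ← Real.exp_add, neg_add_cancel, Real.exp_zero] at this
    simpa only [mul_div_assoc] using this
  rw [oneP_eq_tsum_convAvg hp0 hp1 hf]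
  rw [← Real.norm_eq_abs]
  refine tsum_of_norm_bounded h1 fun n => ?_
  rw [norm_mul, Real.norm_of_nonneg (by positivity)]
  exact mul_le_of_le_one_right (by positivity) (abs_convAvg_le hp0 hp1 hf n k)

theorem oneP_le_of_le (hp0 : ∀ i, 0 ≤ p i) (hp1 : HasSum p 1) (hf0 : ∀ y, 0 ≤ f y)
    (hf : ∀ y, |f y| ≤ 1) {r t : ℝ} (hr : 0 ≤ r) (hrt : r ≤ t) (k : ℤ) :
    oneP p f r k ≤ Real.exp t * oneP p f t k := by
  rw [oneP, oneP, ← tsum_mul_left]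
  refine (summable_shift_mul (summable_ctPMF hp0 hp1 hr) (ctPMF_nonneg hp0 hr) hf k).tsum_le_tsum
    (fun y => ?_) ((summable_shift_mul (summable_ctPMF hp0 hp1 (hr.trans hrt))
      (ctPMF_nonneg hp0 (hr.trans hrt)) hf k).mul_left _)
  rw [← mul_assoc]
  exact mul_le_mul_of_nonneg_right (ctPMF_le_of_le hp0 hp1 hr hrt _) (hf0 y)

theorem oneP_zero (k : ℤ) : oneP p f 0 k = f k := by
  have h : ∀ x, ctPMF p 0 x = if x = 0 then 1 else 0 := by
    intro x
    rw [ctPMF, tsum_eq_single 0 (fun n hn => by simp [hn])]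
    simp [convPow]
  rw [oneP, tsum_eq_single k (fun y hy => by simp [h, sub_eq_zero, hy])]
  simp [h]

theorem summable_oneP_of_finite_support (hp0 : ∀ i, 0 ≤ p i) (hp1 : HasSum p 1) (S : Finset ℤ)
    (hS : ∀ y ∉ S, f y = 0) {t : ℝ} (ht : 0 ≤ t) : Summable (oneP p f t) := by
  have h : oneP p f t = fun k => ∑ y ∈ S, ctPMF p t (y - k) * f y :=
    funext fun k => tsum_eq_sum fun y hy => by rw [hS y hy, mul_zero]
  rw [h]
  exact summable_sum fun y _ =>
    (hasSum_shift_left (summable_ctPMF hp0 hp1 ht).hasSum y).summable.mul_right _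

/-- The tail of the walk started at `x` is the semigroup applied to a half-line. -/
theorem ctTailGt_eq_oneP (t z : ℝ) (x : ℤ) :
    ctTailGt p t (z - x) = oneP p (fun y => if z < (y : ℝ) then 1 else 0) t x := by
  rw [ctTailGt, oneP, ← (Equiv.subRight x).tsum_eq]
  refine tsum_congr fun y => ?_
  simp [sub_lt_sub_iff_right]

theorem ctTailGt_antitone (hp0 : ∀ i, 0 ≤ p i) (hp1 : HasSum p 1) {t : ℝ} (ht : 0 ≤ t) {a b : ℝ}
    (hab : a ≤ b) : ctTailGt p t b ≤ ctTailGt p t a := by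
  have hs : ∀ c : ℝ, Summable fun x : ℤ => if c < (x : ℝ) then ctPMF p t x else 0 := fun c =>
    (summable_ctPMF hp0 hp1 ht).of_nonneg_of_le
      (fun x => by split_ifs <;> simp [ctPMF_nonneg hp0 ht])
      (fun x => by split_ifs <;> simp [ctPMF_nonneg hp0 ht])
  refine (hs b).tsum_le_tsum (fun x => ?_) (hs a)
  have := ctPMF_nonneg hp0 ht x
  split_ifs <;> linarith

/-- Chernoff bound for the tail of the walk. -/
theorem ctTailGt_le_exp (hp0 : ∀ i, 0 ≤ p i) {θ : ℝ} (hθ : 0 ≤ θ)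
    (hM : Summable fun x : ℤ => Real.exp (θ * x) * p x) {t : ℝ} (ht : 0 ≤ t) (a : ℝ) :
    ctTailGt p t a ≤ (∑' x : ℤ, Real.exp (θ * x) * ctPMF p t x) * Real.exp (-(θ * a)) := by
  rw [ctTailGt, ← tsum_mul_right]
  have hx : ∀ x : ℤ, (if a < (x : ℝ) then ctPMF p t x else 0) ≤
      Real.exp (θ * x) * ctPMF p t x * Real.exp (-(θ * a)) := by
    intro x
    have h0 := ctPMF_nonneg hp0 ht x
    split_ifs with h
    · rw [mul_right_comm, ← Real.exp_add]
      refine le_mul_of_one_le_left h0 (Real.one_le_exp ?_)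
      nlinarith
    · positivity
  have hR := (summable_exp_ctPMF hp0 hM ht).mul_right (Real.exp (-(θ * a)))
  refine Summable.tsum_le_tsum hx (hR.of_nonneg_of_le (fun x => ?_) hx) hR
  split_ifs <;> simp [ctPMF_nonneg hp0 ht]

end OneParticle

section PairGenerator

/-- The profile `g` averaged over one step of the walk started at `j`. -/
noncomputable def stepAvg (p g : ℤ → ℝ) (j : ℤ) : ℝ := ∑' z : ℤ, p (z - j) * g z

/-- The two-particle exclusion generator written for functions vanishing on the diagonal. -/
noncomputable def pairGen (p : ℤ → ℝ) (G : ℤ → ℤ → ℝ) (j k : ℤ) : ℝ :=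
  stepAvg p (fun z => G z k) j + stepAvg p (fun z => G j z) k - 2 * (1 - p (k - j)) * G j k

/-- The function `f` with its diagonal replaced by zero. -/
def offDiag (f : ℤ → ℤ → ℝ) (j k : ℤ) : ℝ := if j = k then 0 else f j k

variable {p : ℤ → ℝ}

theorem abs_offDiag_le {f : ℤ → ℤ → ℝ} (hf : ∀ j k, |f j k| ≤ 1) (j k : ℤ) :
    |offDiag f j k| ≤ 1 := by
  rw [offDiag]; split_ifs <;> simp [hf]

theorem abs_stepAvg_le (hp0 : ∀ i, 0 ≤ p i) (hp1 : HasSum p 1) {g : ℤ → ℝ}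
    (hg : ∀ y, |g y| ≤ 1) (j : ℤ) : |stepAvg p g j| ≤ 1 :=
  abs_tsum_shift_mul_le hp1 hp0 hg j

theorem hasSum_stepAvg (hp0 : ∀ i, 0 ≤ p i) (hp1 : HasSum p 1) {g : ℤ → ℝ}
    (hg : ∀ y, |g y| ≤ 1) (j : ℤ) : HasSum (fun z => p (z - j) * g z) (stepAvg p g j) :=
  (summable_shift_mul hp1.summable hp0 hg j).hasSum

theorem hasSum_exclusion_part (hp0 : ∀ i, 0 ≤ p i) (hp1 : HasSum p 1) {g : ℤ → ℝ}
    (hg : ∀ y, |g y| ≤ 1) (j k : ℤ) (c : ℝ) :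
    HasSum (fun z => if z ≠ k then p (z - j) * (g z - c) else 0)
      (stepAvg p (fun z => if z = k then 0 else g z) j - (1 - p (k - j)) * c) := by
  have h1 := hasSum_stepAvg hp0 hp1 (g := fun z => if z = k then 0 else g z)
    (fun y => by split_ifs <;> simp [hg]) j
  have h2 := (hasSum_shift hp1 j).mul_right c
  have h3 := hasSum_ite_eq k (p (k - j) * c)
  rw [show (1 - p (k - j)) * c = 1 * c - p (k - j) * c by ring]
  refine (h1.sub (h2.sub h3)).congr_fun fun z => ?_
  by_cases hz : z = k
  · simp [hz]
  · simp [hz, mul_sub]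

theorem twoGen_eq_pairGen (hp0 : ∀ i, 0 ≤ p i) (hsym : ∀ i, p (-i) = p i) (hp1 : HasSum p 1)
    {f : ℤ → ℤ → ℝ} (hf : ∀ j k, |f j k| ≤ 1) {j k : ℤ} (hjk : j ≠ k) :
    twoGen p f j k = pairGen p (offDiag f) j k := by
  rw [twoGen, (hasSum_exclusion_part hp0 hp1 (fun y => hf y k) j k (f j k)).tsum_eq,
    (hasSum_exclusion_part hp0 hp1 (fun y => hf j y) k j (f j k)).tsum_eq, pairGen,
    show p (j - k) = p (k - j) by rw [← hsym, neg_sub]]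
  simp only [offDiag, hjk, if_false, eq_comm (a := j)]
  ring

theorem stepAvg_nonneg (hp0 : ∀ i, 0 ≤ p i) {g : ℤ → ℝ} (hg : ∀ y, 0 ≤ g y) (j : ℤ) :
    0 ≤ stepAvg p g j :=
  tsum_nonneg fun z => mul_nonneg (hp0 _) (hg z)

theorem summable_step_prod (hp0 : ∀ i, 0 ≤ p i) (hp1 : HasSum p 1) {a : ℤ → ℝ}
    (ha0 : ∀ y, 0 ≤ a y) (ha : Summable a) :
    Summable fun q : ℤ × ℤ => p (q.2 - q.1) * a q.1 := by
  refine (summable_prod_of_nonneg fun q => mul_nonneg (hp0 _) (ha0 _)).mpr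
    ⟨fun j => (hasSum_shift hp1 j).summable.mul_right (a j), ?_⟩
  simpa only [tsum_mul_right, (hasSum_shift hp1 _).tsum_eq, one_mul] using ha

theorem summable_step_prod' (hp0 : ∀ i, 0 ≤ p i) (hsym : ∀ i, p (-i) = p i) (hp1 : HasSum p 1)
    {a : ℤ → ℝ} (ha0 : ∀ y, 0 ≤ a y) (ha : Summable a) :
    Summable fun q : ℤ × ℤ => p (q.2 - q.1) * a q.2 :=
  (summable_step_prod hp0 hp1 ha0 ha).prod_symm.congr fun q => by
    rw [Prod.fst_swap, Prod.snd_swap, ← hsym, neg_sub]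

theorem summable_stepAvg (hp0 : ∀ i, 0 ≤ p i) (hsym : ∀ i, p (-i) = p i) (hp1 : HasSum p 1)
    {a : ℤ → ℝ} (ha0 : ∀ y, 0 ≤ a y) (ha : Summable a) : Summable (stepAvg p a) :=
  (summable_step_prod' hp0 hsym hp1 ha0 ha).prod

/-- The averaging operator of a symmetric walk is self-adjoint. -/
theorem tsum_stepAvg_mul (hp0 : ∀ i, 0 ≤ p i) (hsym : ∀ i, p (-i) = p i) (hp1 : HasSum p 1)
    {a g : ℤ → ℝ} (ha0 : ∀ y, 0 ≤ a y) (ha : Summable a) (hg : ∀ y, |g y| ≤ 1) :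
    ∑' j, stepAvg p g j * a j = ∑' j, g j * stepAvg p a j := by
  have hs : Summable fun q : ℤ × ℤ => p (q.2 - q.1) * g q.2 * a q.1 := by
    refine (summable_step_prod hp0 hp1 ha0 ha).of_norm_bounded fun q => ?_
    rw [norm_mul, norm_mul, Real.norm_of_nonneg (hp0 _), Real.norm_of_nonneg (ha0 _)]
    exact mul_le_mul_of_nonneg_right (mul_le_of_le_one_right (hp0 _) (hg _)) (ha0 _)
  simp only [stepAvg, ← tsum_mul_left, ← tsum_mul_right]
  refine (hs.tsum_comm (f := fun j z => p (z - j) * g z * a j)).symm.trans ?_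
  refine tsum_congr fun z => tsum_congr fun j => ?_
  rw [← hsym, neg_sub]
  ring

section TestFunction

variable {G : ℤ → ℤ → ℝ} {a : ℤ → ℝ}

theorem summable_prod_of_abs_le {b c : ℤ → ℝ} (hb0 : ∀ y, 0 ≤ b y) (hb : Summable b)
    (hc0 : ∀ y, 0 ≤ c y) (hc : Summable c) {K : ℤ × ℤ → ℝ} (hK : ∀ q, |K q| ≤ 1) :
    Summable fun q : ℤ × ℤ => K q * (b q.1 * c q.2) := by
  refine (hb.mul_of_nonneg hc hb0 hc0).of_norm_bounded fun q => ?_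
  rw [norm_mul, Real.norm_of_nonneg (mul_nonneg (hb0 _) (hc0 _))]
  exact mul_le_of_le_one_left (mul_nonneg (hb0 _) (hc0 _)) (hK q)

theorem exists_hasSum_stepAvg_snd (hp0 : ∀ i, 0 ≤ p i) (hsym : ∀ i, p (-i) = p i)
    (hp1 : HasSum p 1) (hG : ∀ j k, |G j k| ≤ 1) (ha0 : ∀ y, 0 ≤ a y) (ha : Summable a) :
    ∃ α, HasSum (fun q : ℤ × ℤ => stepAvg p (fun z => G q.1 z) q.2 * (a q.1 * a q.2)) α ∧
      HasSum (fun q : ℤ × ℤ => G q.1 q.2 * (a q.1 * stepAvg p a q.2)) α := by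
  have h1 := summable_prod_of_abs_le ha0 ha ha0 ha
    (K := fun q => stepAvg p (fun z => G q.1 z) q.2) (fun q => abs_stepAvg_le hp0 hp1 (hG q.1) _)
  have h2 := summable_prod_of_abs_le ha0 ha (stepAvg_nonneg hp0 ha0)
    (summable_stepAvg hp0 hsym hp1 ha0 ha) (K := fun q => G q.1 q.2) (fun q => hG _ _)
  refine ⟨_, h1.hasSum, h2.hasSum_iff.mpr ?_⟩
  rw [h1.tsum_prod, h2.tsum_prod]
  refine tsum_congr fun j => ?_
  have h3 := congrArg (a j * ·) (tsum_stepAvg_mul hp0 hsym hp1 ha0 ha (hG j))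
  simp only [← tsum_mul_left] at h3
  refine Eq.trans (tsum_congr fun k => ?_) (h3.symm.trans (tsum_congr fun k => ?_)) <;> ring

theorem exists_hasSum_stepAvg_fst (hp0 : ∀ i, 0 ≤ p i) (hsym : ∀ i, p (-i) = p i)
    (hp1 : HasSum p 1) (hG : ∀ j k, |G j k| ≤ 1) (ha0 : ∀ y, 0 ≤ a y) (ha : Summable a) :
    ∃ α, HasSum (fun q : ℤ × ℤ => stepAvg p (fun z => G z q.2) q.1 * (a q.1 * a q.2)) α ∧
      HasSum (fun q : ℤ × ℤ => G q.1 q.2 * (stepAvg p a q.1 * a q.2)) α := by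
  obtain ⟨α, h1, h2⟩ := exists_hasSum_stepAvg_snd hp0 hsym hp1 (G := fun j k => G k j)
    (fun j k => hG k j) ha0 ha
  refine ⟨α, ((Equiv.prodComm ℤ ℤ).hasSum_iff.mpr h1).congr_fun fun q => ?_,
    ((Equiv.prodComm ℤ ℤ).hasSum_iff.mpr h2).congr_fun fun q => ?_⟩
  · simp only [Function.comp, Equiv.prodComm_apply, Prod.fst_swap, Prod.snd_swap]
    ring
  · simp only [Function.comp, Equiv.prodComm_apply, Prod.fst_swap, Prod.snd_swap]
    ring

theorem hasSum_diagonal {c : ℤ → ℝ} {s : ℝ} (hc : HasSum c s) :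
    HasSum (fun q : ℤ × ℤ => if q.1 = q.2 then c q.1 else 0) s := by
  have hinj : Function.Injective fun j : ℤ => (j, j) := fun x y h => (Prod.ext_iff.mp h).1
  refine (hinj.hasSum_iff fun q hq => ?_).mp (by simpa [Function.comp_def] using hc)
  refine if_neg fun h => hq ⟨q.1, ?_⟩
  ext <;> simp [h]

/-- The difference between the exclusion and the independent generators, tested against a
product function, is nonpositive. -/
theorem tsum_pairGen_mul_sub_nonpos (hp0 : ∀ i, 0 ≤ p i) (hsym : ∀ i, p (-i) = p i)
    (hp1 : HasSum p 1) (hG : ∀ j k, |G j k| ≤ 1) (hG0 : ∀ j k, 0 ≤ G j k)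
    (hdiag : ∀ j, G j j = 0) (ha0 : ∀ y, 0 ≤ a y) (ha1 : ∀ y, a y ≤ 1) (ha : Summable a) :
    ∑' q : ℤ × ℤ, (if q.1 = q.2 then 0 else
      pairGen p G q.1 q.2 * (a q.1 * a q.2) - G q.1 q.2 *
        ((stepAvg p a q.1 - a q.1) * a q.2 + a q.1 * (stepAvg p a q.2 - a q.2))) ≤ 0 := by
  obtain ⟨α, hα, hα'⟩ := exists_hasSum_stepAvg_fst hp0 hsym hp1 hG ha0 ha
  obtain ⟨β, hβ, hβ'⟩ := exists_hasSum_stepAvg_snd hp0 hsym hp1 hG ha0 ha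
  have hsq0 : ∀ y, 0 ≤ a y ^ 2 := fun y => sq_nonneg _
  have hsq : Summable fun y => a y ^ 2 :=
    ha.of_nonneg_of_le hsq0 fun y => by nlinarith [ha0 y, ha1 y]
  have hG1 : ∀ j k, G j k ≤ 1 := fun j k => (le_abs_self _).trans (hG j k)
  have h1 : Summable fun q : ℤ × ℤ => p (q.2 - q.1) * G q.1 q.2 * a q.1 ^ 2 :=
    (summable_step_prod hp0 hp1 hsq0 hsq).of_nonneg_of_le
      (fun q => mul_nonneg (mul_nonneg (hp0 _) (hG0 _ _)) (hsq0 _))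
      fun q => mul_le_mul_of_nonneg_right (mul_le_of_le_one_right (hp0 _) (hG1 _ _)) (hsq0 _)
  have h2 : Summable fun q : ℤ × ℤ => p (q.2 - q.1) * G q.1 q.2 * a q.2 ^ 2 :=
    (summable_step_prod' hp0 hsym hp1 hsq0 hsq).of_nonneg_of_le
      (fun q => mul_nonneg (mul_nonneg (hp0 _) (hG0 _ _)) (hsq0 _))
      fun q => mul_le_mul_of_nonneg_right (mul_le_of_le_one_right (hp0 _) (hG1 _ _)) (hsq0 _)
  have h3 : Summable fun q : ℤ × ℤ => p (q.2 - q.1) * G q.1 q.2 * (a q.1 * a q.2) := by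
    refine summable_prod_of_abs_le ha0 ha ha0 ha fun q => ?_
    rw [abs_mul, abs_of_nonneg (hp0 _)]
    exact mul_le_one₀ (le_hasSum hp1 _ fun _ _ => hp0 _) (abs_nonneg _) (hG _ _)
  have hd1 := hasSum_diagonal (c := fun j => stepAvg p (fun z => G j z) j * a j ^ 2)
    (s := ∑' q : ℤ × ℤ, p (q.2 - q.1) * G q.1 q.2 * a q.1 ^ 2) (by
      refine (h1.prod.hasSum_iff.mpr h1.tsum_prod.symm).congr_fun fun j => ?_
      rw [stepAvg, ← tsum_mul_right])
  have hd2 := hasSum_diagonal (c := fun j => stepAvg p (fun z => G z j) j * a j ^ 2)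
    (s := ∑' q : ℤ × ℤ, p (q.2 - q.1) * G q.1 q.2 * a q.2 ^ 2) (by
      have h4 := h2.prod_symm
      refine (h4.prod.hasSum_iff.mpr ?_).congr_fun fun j => ?_
      · rw [← h4.tsum_prod]
        exact (Equiv.prodComm ℤ ℤ).tsum_eq
          fun q : ℤ × ℤ => p (q.2 - q.1) * G q.1 q.2 * a q.2 ^ 2
      · rw [stepAvg, ← tsum_mul_right]
        refine tsum_congr fun z => ?_
        simp only [Prod.swap]
        rw [← hsym, neg_sub])
  have hsum := (((((hα.add hβ).sub hα').sub hβ').add (h3.hasSum.mul_left 2)).sub hd1).sub hd2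
  have heq : ∀ q : ℤ × ℤ, (if q.1 = q.2 then 0 else
      pairGen p G q.1 q.2 * (a q.1 * a q.2) - G q.1 q.2 *
        ((stepAvg p a q.1 - a q.1) * a q.2 + a q.1 * (stepAvg p a q.2 - a q.2))) =
      stepAvg p (fun z => G z q.2) q.1 * (a q.1 * a q.2)
        + stepAvg p (fun z => G q.1 z) q.2 * (a q.1 * a q.2)
        - G q.1 q.2 * (stepAvg p a q.1 * a q.2) - G q.1 q.2 * (a q.1 * stepAvg p a q.2)
        + 2 * (p (q.2 - q.1) * G q.1 q.2 * (a q.1 * a q.2))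
        - (if q.1 = q.2 then stepAvg p (fun z => G q.1 z) q.1 * a q.1 ^ 2 else 0)
        - (if q.1 = q.2 then stepAvg p (fun z => G z q.1) q.1 * a q.1 ^ 2 else 0) := by
    rintro ⟨j, k⟩
    by_cases hjk : j = k
    · subst hjk
      simp only [hdiag, if_true]
      ring
    · simp only [hjk, if_false, pairGen]
      ring
  rw [tsum_congr heq, hsum.tsum_eq]
  have hpos : 0 ≤ ∑' q : ℤ × ℤ, (p (q.2 - q.1) * G q.1 q.2 * a q.1 ^ 2
      + p (q.2 - q.1) * G q.1 q.2 * a q.2 ^ 2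
      - 2 * (p (q.2 - q.1) * G q.1 q.2 * (a q.1 * a q.2))) := by
    refine tsum_nonneg fun q => ?_
    have := mul_nonneg (mul_nonneg (hp0 (q.2 - q.1)) (hG0 q.1 q.2)) (sq_nonneg (a q.1 - a q.2))
    linarith
  rw [(h1.add h2).tsum_sub (h3.mul_left 2), h1.tsum_add h2, tsum_mul_left] at hpos
  linarith

end TestFunction

end PairGenerator

section PairEvolution

/-- `G` is a bounded solution, vanishing on the diagonal and at time `0`, of the Kolmogorov equation
of two exclusion particles with nonnegative source `F`. -/
structure IsPairEvolution (p : ℤ → ℝ) (F G : ℝ → ℤ → ℤ → ℝ) : Prop where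
  diag : ∀ s j, G s j j = 0
  initial : ∀ j k, G 0 j k = 0
  abs_le_one : ∀ s, 0 ≤ s → ∀ j k, |G s j k| ≤ 1
  source_nonneg : ∀ s j k, 0 ≤ F s j k
  source_le : ∀ s, 0 ≤ s → ∀ j k, F s j k ≤ 1
  source_continuous : ∀ j k, Continuous fun s => F s j k
  deriv : ∀ j k, j ≠ k → ∀ s, 0 ≤ s →
    HasDerivWithinAt (fun s => G s j k) (pairGen p (G s) j k + F s j k) (Set.Ici 0) s

variable {p : ℤ → ℝ} {F G : ℝ → ℤ → ℤ → ℝ}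

theorem continuousOn_stepAvg (hp0 : ∀ i, 0 ≤ p i) (hp1 : HasSum p 1) {g : ℝ → ℤ → ℝ} {S : Set ℝ}
    (hc : ∀ z, ContinuousOn (fun s => g s z) S) (hg : ∀ s ∈ S, ∀ z, |g s z| ≤ 1) (j : ℤ) :
    ContinuousOn (fun s => stepAvg p (g s) j) S := by
  refine continuousOn_tsum (fun z => continuousOn_const.mul (hc z)) (hasSum_shift hp1 j).summable
    fun z s hs => ?_
  rw [norm_mul, Real.norm_of_nonneg (hp0 _)]
  exact mul_le_of_le_one_right (hp0 _) (hg s hs z)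

theorem stepAvg_mono (hp0 : ∀ i, 0 ≤ p i) {a b : ℤ → ℝ} (ha0 : ∀ y, 0 ≤ a y)
    (hab : ∀ y, a y ≤ b y) {j : ℤ} (hb : Summable fun z => p (z - j) * b z) :
    stepAvg p a j ≤ stepAvg p b j :=
  (hb.of_nonneg_of_le (fun z => mul_nonneg (hp0 _) (ha0 z))
    fun z => mul_le_mul_of_nonneg_left (hab z) (hp0 _)).tsum_le_tsum
    (fun z => mul_le_mul_of_nonneg_left (hab z) (hp0 _)) hb

theorem neg_mul_stepAvg_le (hp0 : ∀ i, 0 ≤ p i) (hp1 : HasSum p 1) {g : ℤ → ℝ}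
    (hg : ∀ y, |g y| ≤ 1) {c M : ℝ} (hM : ∀ y, -(c * g y) ≤ M) (j : ℤ) :
    -(c * stepAvg p g j) ≤ M := by
  have h1 := ((hasSum_stepAvg hp0 hp1 hg j).mul_left c).neg
  have h2 := (hasSum_shift hp1 j).mul_right M
  rw [one_mul] at h2
  refine hasSum_le (fun z => ?_) h1 h2
  have := mul_le_mul_of_nonneg_left (hM z) (hp0 (z - j))
  linarith

namespace IsPairEvolution

theorem continuousOn (hG : IsPairEvolution p F G) (t : ℝ) (j k : ℤ) :
    ContinuousOn (fun s => G s j k) (Set.Icc 0 t) := by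
  by_cases hjk : j = k
  · subst hjk
    simpa only [hG.diag] using continuousOn_const
  · exact fun s hs => ((hG.deriv j k hjk s hs.1).continuousWithinAt).mono Set.Icc_subset_Ici_self

theorem hasDerivWithinAt_exp_mul (hG : IsPairEvolution p F G) {j k : ℤ} (hjk : j ≠ k) {s : ℝ}
    (hs : 0 ≤ s) :
    HasDerivWithinAt (fun s => Real.exp (2 * s) * G s j k)
      (Real.exp (2 * s) * (stepAvg p (fun z => G s z k) j + stepAvg p (fun z => G s j z) k
        + 2 * p (k - j) * G s j k + F s j k)) (Set.Ici s) s := by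
  have h1 : HasDerivAt (fun s : ℝ => Real.exp (2 * s)) (Real.exp (2 * s) * 2) s := by
    simpa using ((hasDerivAt_id s).const_mul 2).exp
  refine (h1.hasDerivWithinAt.mul
    ((hG.deriv j k hjk s hs).mono (Set.Ici_subset_Ici.mpr hs))).congr_deriv ?_
  rw [pairGen]
  ring

theorem continuousOn_exp_mul (hG : IsPairEvolution p F G) (t : ℝ) (j k : ℤ) :
    ContinuousOn (fun s => Real.exp (2 * s) * G s j k) (Set.Icc 0 t) :=
  (by fun_prop : Continuous fun s : ℝ => Real.exp (2 * s)).continuousOn.mul (hG.continuousOn t j k)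

theorem neg_exp_mul_le (hG : IsPairEvolution p F G) (hp0 : ∀ i, 0 ≤ p i) (hp1 : HasSum p 1)
    {t : ℝ} (n : ℕ) : ∀ s ∈ Set.Icc 0 t, ∀ j k,
      -(Real.exp (2 * s) * G s j k) ≤ Real.exp (2 * t) * ((4 * s) ^ n / n.factorial) := by
  induction n with
  | zero =>
    intro s hs j k
    have h1 : Real.exp (2 * s) ≤ Real.exp (2 * t) := Real.exp_le_exp.mpr (by linarith [hs.2])
    have h2 := neg_le_of_abs_le (hG.abs_le_one s hs.1 j k)
    have h3 := Real.exp_pos (2 * s)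
    simp only [pow_zero, Nat.factorial_zero, Nat.cast_one, div_one, mul_one]
    nlinarith
  | succ n ih =>
    intro s hs j k
    by_cases hjk : j = k
    · subst hjk
      rw [hG.diag, mul_zero, neg_zero]
      have := hs.1
      positivity
    refine image_le_of_deriv_right_le_deriv_boundary (hG.continuousOn_exp_mul t j k).neg
      (fun x hx => (hG.hasDerivWithinAt_exp_mul hjk hx.1).neg) (by simp [hG.initial])
      (B := fun s => Real.exp (2 * t) * ((4 * s) ^ (n + 1) / (n + 1).factorial))
      (B' := fun s => Real.exp (2 * t) * (4 * ((4 * s) ^ n / n.factorial)))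
      (by fun_prop) (fun x _ => ?_) (fun x hx => ?_) hs
    · refine HasDerivAt.hasDerivWithinAt ?_
      have h1 : HasDerivAt (fun s : ℝ => 4 * s) 4 x := by simpa using (hasDerivAt_id x).const_mul 4
      refine (((h1.pow (n + 1)).div_const _).const_mul _).congr_deriv ?_
      rw [Nat.factorial_succ, Nat.add_sub_cancel]
      push_cast
      field_simp
    · have hx' : x ∈ Set.Icc 0 t := Set.Ico_subset_Icc_self hx
      have hA := neg_mul_stepAvg_le hp0 hp1 (hG.abs_le_one x hx.1 · k) (ih x hx' · k) j
      have hB := neg_mul_stepAvg_le hp0 hp1 (hG.abs_le_one x hx.1 j) (ih x hx' j) k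
      have hC := ih x hx' j k
      have hF := mul_nonneg (Real.exp_pos (2 * x)).le (hG.source_nonneg x j k)
      have hp : p (k - j) ≤ 1 := le_hasSum hp1 _ fun _ _ => hp0 _
      have hM : 0 ≤ Real.exp (2 * t) * ((4 * x) ^ n / n.factorial) := by
        have := hx.1
        positivity
      have hD := mul_le_mul_of_nonneg_left hC (hp0 (k - j))
      have hE := mul_le_mul_of_nonneg_right hp hM
      linarith

/-- The minimum principle for the two-particle exclusion process. -/
theorem nonneg (hG : IsPairEvolution p F G) (hp0 : ∀ i, 0 ≤ p i) (hp1 : HasSum p 1) {t : ℝ}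
    (ht : 0 ≤ t) (j k : ℤ) : 0 ≤ G t j k := by
  have h := ge_of_tendsto' ((FloorSemiring.tendsto_pow_div_factorial_atTop (4 * t)).const_mul
    (Real.exp (2 * t))) fun n => hG.neg_exp_mul_le hp0 hp1 n t ⟨ht, le_rfl⟩ j k
  rw [mul_zero, neg_nonpos] at h
  exact nonneg_of_mul_nonneg_right h (Real.exp_pos _)

theorem integral_source_le (hG : IsPairEvolution p F G) (hp0 : ∀ i, 0 ≤ p i) (hp1 : HasSum p 1)
    {t : ℝ} (ht : 0 ≤ t) {j k : ℤ} (hjk : j ≠ k) :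
    ∫ s in (0 : ℝ)..t, F s j k ≤ Real.exp (2 * t) * G t j k := by
  have hF : ∀ x, HasDerivAt (fun u => ∫ s in (0 : ℝ)..u, F s j k) (F x j k) x := fun x =>
    ((hG.source_continuous j k).integral_hasStrictDerivAt 0 x).hasDerivAt
  refine image_le_of_deriv_right_le_deriv_boundary
    (fun x _ => (hF x).continuousAt.continuousWithinAt) (fun x _ => (hF x).hasDerivWithinAt)
    (by simp [hG.initial]) (hG.continuousOn_exp_mul t j k)
    (fun x hx => hG.hasDerivWithinAt_exp_mul hjk hx.1) (fun x hx => ?_)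
    (Set.right_mem_Icc.mpr ht)
  have h0 := hG.nonneg hp0 hp1 hx.1
  have hA := stepAvg_nonneg hp0 (h0 · k) j
  have hB := stepAvg_nonneg hp0 (h0 j) k
  have hC := mul_nonneg (mul_nonneg zero_le_two (hp0 (k - j))) (h0 j k)
  have hF0 := hG.source_nonneg x j k
  have he : 1 ≤ Real.exp (2 * x) := Real.one_le_exp (by linarith [hx.1])
  nlinarith

/-- Testing a pair evolution against the product of two independent walk semigroups. -/
theorem tsum_mul_le (hG : IsPairEvolution p F G) (hp0 : ∀ i, 0 ≤ p i) (hsym : ∀ i, p (-i) = p i)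
    (hp1 : HasSum p 1) {φ : ℤ → ℝ} (hφ0 : ∀ y, 0 ≤ φ y) (hφ1 : ∀ y, φ y ≤ 1) (S : Finset ℤ)
    (hS : ∀ y ∉ S, φ y = 0) {t : ℝ} (ht : 0 ≤ t) :
    (Summable fun q : ℤ × ℤ => ∫ s in (0 : ℝ)..t,
      F s q.1 q.2 * (oneP p φ (t - s) q.1 * oneP p φ (t - s) q.2)) ∧
    ∑' q : ℤ × ℤ, G t q.1 q.2 * (φ q.1 * φ q.2) ≤
      ∑' q : ℤ × ℤ, ∫ s in (0 : ℝ)..t,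
        F s q.1 q.2 * (oneP p φ (t - s) q.1 * oneP p φ (t - s) q.2) := by
  have hφ : ∀ y, |φ y| ≤ 1 := fun y => by rw [abs_of_nonneg (hφ0 y)]; exact hφ1 y
  set a : ℝ → ℤ → ℝ := oneP p φ with ha_def
  set b : ℤ → ℝ := fun y => Real.exp t * a t y with hb_def
  have ha0 : ∀ s ∈ Set.Icc 0 t, ∀ y, 0 ≤ a (t - s) y := fun s hs y =>
    oneP_nonneg hp0 hφ0 (sub_nonneg.mpr hs.2) y
  have hab : ∀ s ∈ Set.Icc 0 t, ∀ y, |a (t - s) y| ≤ 1 := fun s hs y =>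
    abs_oneP_le hp0 hp1 hφ (sub_nonneg.mpr hs.2) y
  have hale : ∀ s ∈ Set.Icc 0 t, ∀ y, a (t - s) y ≤ b y := fun s hs y =>
    oneP_le_of_le hp0 hp1 hφ0 hφ (sub_nonneg.mpr hs.2) (by linarith [hs.1]) y
  have hat0 : ∀ y, 0 ≤ a t y := oneP_nonneg hp0 hφ0 ht
  have hb0 : ∀ y, 0 ≤ b y := fun y => mul_nonneg (Real.exp_pos _).le (hat0 y)
  have hasum : ∀ s ∈ Set.Icc 0 t, Summable (a (t - s)) := fun s hs =>
    summable_oneP_of_finite_support hp0 hp1 S hS (sub_nonneg.mpr hs.2)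
  have hbs : Summable b := (summable_oneP_of_finite_support hp0 hp1 S hS ht).mul_left _
  have hcs : Summable (stepAvg p b) := summable_stepAvg hp0 hsym hp1 hb0 hbs
  have hc0 : ∀ y, 0 ≤ stepAvg p b y := stepAvg_nonneg hp0 hb0
  have hale' : ∀ s ∈ Set.Icc 0 t, ∀ y, stepAvg p (a (t - s)) y ≤ stepAvg p b y :=
    fun s hs y => stepAvg_mono hp0 (ha0 s hs) (hale s hs)
      ((summable_step_prod' hp0 hsym hp1 hb0 hbs).prod_factor y)
  have ha0' : ∀ s ∈ Set.Icc 0 t, ∀ y, 0 ≤ stepAvg p (a (t - s)) y :=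
    fun s hs y => stepAvg_nonneg hp0 (ha0 s hs) y
  have hac : ∀ y, Continuous fun s => a (t - s) y := fun y =>
    (continuous_oneP hp0 hp1 hφ y).comp (continuous_const.sub continuous_id)
  set d : ℤ × ℤ → ℝ → ℝ := fun q s => if q.1 = q.2 then 0 else
      pairGen p (G s) q.1 q.2 * (a (t - s) q.1 * a (t - s) q.2) - G s q.1 q.2 *
        ((stepAvg p (a (t - s)) q.1 - a (t - s) q.1) * a (t - s) q.2
          + a (t - s) q.1 * (stepAvg p (a (t - s)) q.2 - a (t - s) q.2)) with hd_def
  have hdc : ∀ q, ContinuousOn (d q) (Set.Icc 0 t) := by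
    rintro ⟨j, k⟩
    by_cases hjk : j = k
    · simpa only [hd_def, hjk, if_true] using continuousOn_const
    have hA := continuousOn_stepAvg hp0 hp1 (S := Set.Icc 0 t) (fun z => hG.continuousOn t z k)
      (fun s hs z => hG.abs_le_one s hs.1 z k) j
    have hB := continuousOn_stepAvg hp0 hp1 (S := Set.Icc 0 t) (fun z => hG.continuousOn t j z)
      (fun s hs z => hG.abs_le_one s hs.1 j z) k
    have hC := hG.continuousOn t j k
    have hD := continuousOn_stepAvg hp0 hp1 (S := Set.Icc 0 t) (fun z => (hac z).continuousOn) hab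
    have hDj := hD j
    have hDk := hD k
    have hj := (hac j).continuousOn (s := Set.Icc 0 t)
    have hk := (hac k).continuousOn (s := Set.Icc 0 t)
    simp only [hd_def, hjk, if_false, pairGen]
    exact (((hA.add hB).sub (continuousOn_const.mul hC)).mul (hj.mul hk)).sub
      (hC.mul (((hDj.sub hj).mul hk).add (hj.mul (hDk.sub hk))))
  have hFc : ∀ q : ℤ × ℤ, Continuous fun s => F s q.1 q.2 * (a (t - s) q.1 * a (t - s) q.2) :=
    fun q => (hG.source_continuous q.1 q.2).mul ((hac q.1).mul (hac q.2))
  have hdle : ∀ q, ∀ s ∈ Set.Icc 0 t, ‖d q s‖ ≤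
      6 * (b q.1 * b q.2) + (stepAvg p b q.1 * b q.2 + b q.1 * stepAvg p b q.2) := by
    rintro ⟨j, k⟩ s hs
    have hbb := mul_nonneg (hb0 j) (hb0 k)
    have hcb := mul_nonneg (hc0 j) (hb0 k)
    have hbc := mul_nonneg (hb0 j) (hc0 k)
    by_cases hjk : j = k
    · simp only [hd_def, hjk, if_true, norm_zero]
      subst hjk
      positivity
    simp only [hd_def, hjk, if_false, Real.norm_eq_abs]
    have haa : a (t - s) j * a (t - s) k ≤ b j * b k :=
      mul_le_mul (hale s hs j) (hale s hs k) (ha0 s hs k) (hb0 j)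
    have hca : stepAvg p (a (t - s)) j * a (t - s) k ≤ stepAvg p b j * b k :=
      mul_le_mul (hale' s hs j) (hale s hs k) (ha0 s hs k) (hc0 j)
    have hac' : a (t - s) j * stepAvg p (a (t - s)) k ≤ b j * stepAvg p b k :=
      mul_le_mul (hale s hs j) (hale' s hs k) (ha0' s hs k) (hb0 j)
    have haa0 := mul_nonneg (ha0 s hs j) (ha0 s hs k)
    have hca0 := mul_nonneg (ha0' s hs j) (ha0 s hs k)
    have hac0 := mul_nonneg (ha0 s hs j) (ha0' s hs k)
    have hg := hG.abs_le_one s hs.1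
    have hpg : |pairGen p (G s) j k| ≤ 4 := by
      have hA := abs_le.mp (abs_stepAvg_le hp0 hp1 (hg · k) j)
      have hB := abs_le.mp (abs_stepAvg_le hp0 hp1 (hg j) k)
      have hC := abs_le.mp (hg j k)
      have hp : p (k - j) ≤ 1 := le_hasSum hp1 _ fun _ _ => hp0 _
      have hp' := hp0 (k - j)
      have hD : |2 * (1 - p (k - j)) * G s j k| ≤ 2 := by
        rw [abs_mul, abs_of_nonneg (by linarith)]
        nlinarith [hg j k, abs_nonneg (G s j k)]
      have hD' := abs_le.mp hD
      rw [pairGen, abs_le]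
      constructor <;> linarith [hA.1, hA.2, hB.1, hB.2, hD'.1, hD'.2]
    have hX : |pairGen p (G s) j k * (a (t - s) j * a (t - s) k)| ≤ 4 * (b j * b k) := by
      rw [abs_mul, abs_of_nonneg haa0]
      exact mul_le_mul hpg haa haa0 (by norm_num)
    have hY : |G s j k * ((stepAvg p (a (t - s)) j - a (t - s) j) * a (t - s) k
        + a (t - s) j * (stepAvg p (a (t - s)) k - a (t - s) k))| ≤
        2 * (b j * b k) + (stepAvg p b j * b k + b j * stepAvg p b k) := by
      rw [abs_mul]
      refine (mul_le_of_le_one_left (abs_nonneg _) (hg j k)).trans ?_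
      rw [abs_le]
      constructor <;> linarith
    have := (abs_sub _ _).trans (add_le_add hX hY)
    linarith
  have hbnd : Summable fun q : ℤ × ℤ =>
      6 * (b q.1 * b q.2) + (stepAvg p b q.1 * b q.2 + b q.1 * stepAvg p b q.2) :=
    ((hbs.mul_of_nonneg hbs hb0 hb0).mul_left 6).add
      ((hcs.mul_of_nonneg hbs hc0 hb0).add (hbs.mul_of_nonneg hcs hb0 hc0))
  have hIcc : ∀ s ∈ Set.uIoc 0 t, s ∈ Set.Icc 0 t := fun s hs => by
    rw [Set.uIoc_of_le ht] at hs
    exact Set.Ioc_subset_Icc_self hs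
  have hdsum : HasSum (fun q => ∫ s in (0 : ℝ)..t, d q s) (∫ s in (0 : ℝ)..t, ∑' q, d q s) := by
    refine intervalIntegral.hasSum_integral_of_dominated_convergence (fun q _ =>
      6 * (b q.1 * b q.2) + (stepAvg p b q.1 * b q.2 + b q.1 * stepAvg p b q.2)) (fun q => ?_)
      (fun q => ae_of_all _ fun s hs => hdle q s (hIcc s hs))
      (ae_of_all _ fun s hs => hbnd) intervalIntegrable_const
      (ae_of_all _ fun s hs => (hbnd.of_norm_bounded fun q => hdle q s (hIcc s hs)).hasSum)
    rw [Set.uIoc_of_le ht]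
    exact ((hdc q).mono Set.Ioc_subset_Icc_self).aestronglyMeasurable measurableSet_Ioc
  have hdnonpos : ∫ s in (0 : ℝ)..t, ∑' q, d q s ≤ 0 := by
    rw [← neg_nonneg, ← intervalIntegral.integral_neg]
    refine intervalIntegral.integral_nonneg ht fun s hs => neg_nonneg.mpr ?_
    exact tsum_pairGen_mul_sub_nonpos hp0 hsym hp1 (hG.abs_le_one s hs.1) (hG.nonneg hp0 hp1 hs.1)
      (hG.diag s) (ha0 s hs) (fun y => (le_abs_self _).trans (hab s hs y)) (hasum s hs)
  have hFs : Summable fun q : ℤ × ℤ => ∫ s in (0 : ℝ)..t,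
      F s q.1 q.2 * (a (t - s) q.1 * a (t - s) q.2) := by
    refine ((hbs.mul_of_nonneg hbs hb0 hb0).mul_right |t - 0|).of_norm_bounded fun q =>
      intervalIntegral.norm_integral_le_of_norm_le_const fun s hs => ?_
    have hs' := hIcc s hs
    have haa0 := mul_nonneg (ha0 s hs' q.1) (ha0 s hs' q.2)
    rw [Real.norm_of_nonneg (mul_nonneg (hG.source_nonneg _ _ _) haa0)]
    exact (mul_le_of_le_one_left haa0 (hG.source_le s hs'.1 _ _)).trans
      (mul_le_mul (hale s hs' _) (hale s hs' _) (ha0 s hs' _) (hb0 _))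
  refine ⟨hFs, ?_⟩
  have hpt : ∀ q : ℤ × ℤ, G t q.1 q.2 * (φ q.1 * φ q.2) ≤
      (∫ s in (0 : ℝ)..t, F s q.1 q.2 * (a (t - s) q.1 * a (t - s) q.2))
        + ∫ s in (0 : ℝ)..t, d q s := by
    rintro ⟨j, k⟩
    by_cases hjk : j = k
    · simp only [hd_def, hjk, if_true, hG.diag, zero_mul, intervalIntegral.integral_zero, add_zero]
      exact intervalIntegral.integral_nonneg ht fun s hs => mul_nonneg (hG.source_nonneg _ _ _)
        (mul_nonneg (ha0 s hs _) (ha0 s hs _))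
    have hint : IntervalIntegrable (fun s => F s j k * (a (t - s) j * a (t - s) k)) volume 0 t :=
      (hFc (j, k)).intervalIntegrable 0 t
    have hint' : IntervalIntegrable (d (j, k)) volume 0 t :=
      (hdc (j, k)).intervalIntegrable_of_Icc ht
    have hder : ∀ x ∈ Set.Ioo 0 t, HasDerivWithinAt
        (fun s => G s j k * (a (t - s) j * a (t - s) k))
        (F x j k * (a (t - x) j * a (t - x) k) + d (j, k) x) (Set.Ioi x) x := by
      intro x hx
      have h1 := (hG.deriv j k hjk x hx.1.le).mono (Set.Ioi_subset_Ici hx.1.le)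
      have h2 := fun y => (hasDerivAt_oneP hp0 hp1 hφ y (t - x)).comp_const_sub t x
      refine (h1.mul ((h2 j).mul (h2 k)).hasDerivWithinAt).congr_deriv ?_
      simp only [hd_def, ha_def, hjk, if_false, stepAvg, Pi.mul_apply]
      ring
    have hftc := intervalIntegral.integral_eq_sub_of_hasDeriv_right_of_le ht
      ((hG.continuousOn t j k).mul ((hac j).mul (hac k)).continuousOn) hder (hint.add hint')
    rw [intervalIntegral.integral_add hint hint'] at hftc
    simp only [Pi.mul_apply, sub_self, ha_def, oneP_zero, hG.initial, zero_mul, sub_zero] at hftc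
    exact hftc.ge
  have hLs : Summable fun q : ℤ × ℤ => G t q.1 q.2 * (φ q.1 * φ q.2) := by
    refine summable_of_ne_finset_zero (s := S ×ˢ S) fun q hq => ?_
    rw [Finset.mem_product, not_and_or] at hq
    rcases hq with hq | hq <;> simp [hS _ hq]
  calc _ ≤ _ := hLs.tsum_le_tsum hpt (hFs.add hdsum.summable)
    _ = _ := hFs.tsum_add hdsum.summable
    _ ≤ _ := by
      rw [hdsum.tsum_eq]
      linarith

end IsPairEvolution

end PairEvolution

section Correlation

variable {p η : ℤ → ℝ} {h : ℝ → ℤ → ℤ → ℝ}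

theorem stepAvg_punctured_sub (hp0 : ∀ i, 0 ≤ p i) (hp1 : HasSum p 1) {u g : ℤ → ℝ}
    (hu : ∀ y, |u y| ≤ 1) (hg : ∀ y, |g y| ≤ 1) (c : ℝ) (j k : ℤ) :
    stepAvg p (fun z => if z = k then 0 else u z * c - g z) j =
      stepAvg p u j * c - p (k - j) * (u k * c)
        - stepAvg p (fun z => if z = k then 0 else g z) j := by
  have h1 := (hasSum_stepAvg hp0 hp1 hu j).mul_right c
  have h2 := hasSum_ite_eq k (p (k - j) * (u k * c))
  have h3 := hasSum_stepAvg hp0 hp1 (g := fun z => if z = k then 0 else g z)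
    (fun y => by split_ifs <;> simp [hg]) j
  refine (((h1.sub h2).sub h3).congr_fun fun z => ?_).tsum_eq
  by_cases hz : z = k
  · simp [hz, mul_assoc]
  · simp only [hz, if_false]
    ring

/-- The negative covariances of the exclusion process solve the two-particle Kolmogorov equation
with source `p (k - j) * (u j - u k) ^ 2`, where `u` is the mean profile. -/
theorem isPairEvolution_covariance (hp0 : ∀ i, 0 ≤ p i) (hsym : ∀ i, p (-i) = p i)
    (hp1 : HasSum p 1) (hη0 : ∀ k, 0 ≤ η k) (hη : ∀ k, |η k| ≤ 1)
    (h0 : ∀ j k : ℤ, j ≠ k → h 0 j k = η j * η k)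
    (hbdd : ∀ (t : ℝ) (j k : ℤ), 0 ≤ h t j k ∧ h t j k ≤ 1)
    (hderiv : ∀ j k : ℤ, j ≠ k → ∀ t : ℝ, 0 ≤ t →
      HasDerivWithinAt (fun s => h s j k) (twoGen p (h t) j k) (Set.Ici 0) t) :
    IsPairEvolution p (fun s j k => p (k - j) * (oneP p η s j - oneP p η s k) ^ 2)
      (fun s => offDiag fun j k => oneP p η s j * oneP p η s k - h s j k) := by
  have hu0 : ∀ s, 0 ≤ s → ∀ k, 0 ≤ oneP p η s k := fun s hs k => oneP_nonneg hp0 hη0 hs k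
  have huabs : ∀ s, 0 ≤ s → ∀ k, |oneP p η s k| ≤ 1 := fun s hs k => abs_oneP_le hp0 hp1 hη hs k
  have hu1 : ∀ s, 0 ≤ s → ∀ k, oneP p η s k ≤ 1 := fun s hs k =>
    (le_abs_self _).trans (huabs s hs k)
  have huu : ∀ s, 0 ≤ s → ∀ j k, 0 ≤ oneP p η s j * oneP p η s k ∧
      oneP p η s j * oneP p η s k ≤ 1 := fun s hs j k =>
    ⟨mul_nonneg (hu0 s hs j) (hu0 s hs k), mul_le_one₀ (hu1 s hs j) (hu0 s hs k) (hu1 s hs k)⟩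
  have hh : ∀ s j k, |h s j k| ≤ 1 := fun s j k => by
    rw [abs_of_nonneg (hbdd s j k).1]; exact (hbdd s j k).2
  refine ⟨fun s j => by simp [offDiag], fun j k => ?_, fun s hs => abs_offDiag_le fun j k => ?_,
    fun s j k => mul_nonneg (hp0 _) (sq_nonneg _), fun s hs j k => ?_, fun j k => ?_,
    fun j k hjk s hs => ?_⟩
  · by_cases hjk : j = k <;> simp [offDiag, hjk, oneP_zero, h0]
  · have h1 := hbdd s j k
    have h2 := huu s hs j k
    rw [abs_le]
    constructor <;> linarith
  · refine mul_le_one₀ (le_hasSum hp1 _ fun _ _ => hp0 _) (sq_nonneg _) ?_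
    have := hu0 s hs j
    have := hu0 s hs k
    have := hu1 s hs j
    have := hu1 s hs k
    rw [sq_le_one_iff_abs_le_one, abs_le]
    constructor <;> linarith
  · exact continuous_const.mul
      (((continuous_oneP hp0 hp1 hη j).sub (continuous_oneP hp0 hp1 hη k)).pow 2)
  · have h1 := ((hasDerivAt_oneP hp0 hp1 hη j s).mul (hasDerivAt_oneP hp0 hp1 hη k s))
      |>.hasDerivWithinAt (s := Set.Ici 0) |>.sub (hderiv j k hjk s hs)
    have h2 : ∀ r, offDiag (fun j k => oneP p η r j * oneP p η r k - h r j k) j k =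
        oneP p η r j * oneP p η r k - h r j k := fun r => if_neg hjk
    simp only [h2]
    refine h1.congr_deriv ?_
    have h3 := stepAvg_punctured_sub hp0 hp1 (huabs s hs) (hh s · k) (oneP p η s k) j k
    have h4 := stepAvg_punctured_sub hp0 hp1 (huabs s hs) (hh s j) (oneP p η s j) k j
    rw [twoGen_eq_pairGen hp0 hsym hp1 (hh s) hjk, pairGen, pairGen]
    simp only [offDiag, hjk, if_false, eq_comm (a := j), mul_comm (oneP p η s j)]
    rw [h3, h4, show p (j - k) = p (k - j) by rw [← hsym, neg_sub]]
    simp only [stepAvg]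
    ring

end Correlation

section CovarianceSum

/-- The bijection `(i, k) ↦ (k, k + i)` from gaps and left endpoints to pairs. -/
def pairOfGap : ℤ × ℤ ≃ ℤ × ℤ where
  toFun q := (q.2, q.2 + q.1)
  invFun q := (q.2 - q.1, q.1)
  left_inv q := by ext <;> simp
  right_inv q := by ext <;> simp

/-- The involution `(i, k) ↦ (-i, k + i)` exchanging the endpoints of the pair `(k, k + i)`. -/
def gapReflect : ℤ × ℤ ≃ ℤ × ℤ where
  toFun q := (-q.1, q.2 + q.1)
  invFun q := (-q.1, q.2 + q.1)
  left_inv q := by ext <;> simp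
  right_inv q := by ext <;> simp

theorem summable_exp_halfLine {θ : ℝ} (hθ : 0 < θ) (z : ℝ) :
    Summable fun k : ℤ => if (k : ℝ) ≤ z then Real.exp (θ * k) else 0 := by
  have hinj : Function.Injective fun m : ℕ => ⌊z⌋ - (m : ℤ) := fun m n hmn => by
    simpa using hmn
  refine (hinj.summable_iff fun k hk => if_neg fun hkz => hk ?_).mp ?_
  · have := Int.le_floor.mpr hkz
    exact ⟨(⌊z⌋ - k).toNat, by simp only; omega⟩
  · refine ((Real.summable_exp_nat_mul_iff.mpr (neg_neg_of_pos hθ)).mul_left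
      (Real.exp (θ * ⌊z⌋))).congr fun m => ?_
    have hm : ((⌊z⌋ - (m : ℤ) : ℤ) : ℝ) ≤ z := by
      push_cast
      linarith [Int.floor_le z, (Nat.cast_nonneg m : (0 : ℝ) ≤ m)]
    rw [Function.comp, if_pos hm, ← Real.exp_add]
    push_cast
    ring_nf

end CovarianceSum

section DualityBound

variable {p η : ℤ → ℝ}

/-- Indicator of the sites strictly to the right of `z`. -/
noncomputable def rightIndicator (z : ℝ) (y : ℤ) : ℝ := if z < (y : ℝ) then 1 else 0

theorem rightIndicator_nonneg (z : ℝ) (y : ℤ) : 0 ≤ rightIndicator z y := by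
  unfold rightIndicator; split_ifs <;> norm_num

theorem rightIndicator_le_one (z : ℝ) (y : ℤ) : rightIndicator z y ≤ 1 := by
  unfold rightIndicator; split_ifs <;> norm_num

theorem abs_rightIndicator_le (z : ℝ) (y : ℤ) : |rightIndicator z y| ≤ 1 := by
  rw [abs_of_nonneg (rightIndicator_nonneg z y)]; exact rightIndicator_le_one z y

theorem oneP_rightIndicator (t z : ℝ) (x : ℤ) :
    oneP p (rightIndicator z) t x = ctTailGt p t (z - x) := (ctTailGt_eq_oneP t z x).symm

theorem oneP_rightIndicator_mono (hp0 : ∀ i, 0 ≤ p i) (hp1 : HasSum p 1) {t : ℝ} (ht : 0 ≤ t)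
    (z : ℝ) : Monotone (oneP p (rightIndicator z) t) := fun j k hjk => by
  rw [oneP_rightIndicator, oneP_rightIndicator]
  exact ctTailGt_antitone hp0 hp1 ht (sub_le_sub_left (by exact_mod_cast hjk) z)

/-- Contribution of the pair `(k, k + i)`, `i ≥ 1`, to the duality bound for the covariance sum. -/
noncomputable def gapTerm (p η : ℤ → ℝ) (z t : ℝ) (q : ℤ × ℤ) : ℝ :=
  if 1 ≤ q.1 then p q.1 * ∫ s in (0 : ℝ)..t, (oneP p η s q.2 - oneP p η s (q.2 + q.1)) ^ 2 *
    oneP p (rightIndicator z) (t - s) (q.2 + q.1) ^ 2 else 0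

theorem gapTerm_nonneg (hp0 : ∀ i, 0 ≤ p i) (z : ℝ) {t : ℝ} (ht : 0 ≤ t) (q : ℤ × ℤ) :
    0 ≤ gapTerm p η z t q := by
  unfold gapTerm
  split_ifs
  · exact mul_nonneg (hp0 _) (intervalIntegral.integral_nonneg ht fun s _ => by positivity)
  · exact le_rfl

theorem integral_le_gapTerm (hp0 : ∀ i, 0 ≤ p i) (hp1 : HasSum p 1) (hη : ∀ k, |η k| ≤ 1)
    {φ : ℤ → ℝ} {z : ℝ} (hφ0 : ∀ y, 0 ≤ φ y) (hφ : ∀ y, φ y ≤ rightIndicator z y) {t : ℝ}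
    (ht : 0 ≤ t) {i : ℤ} (hi : 1 ≤ i) (k : ℤ) :
    ∫ s in (0 : ℝ)..t, p i * (oneP p η s k - oneP p η s (k + i)) ^ 2 *
      (oneP p φ (t - s) k * oneP p φ (t - s) (k + i)) ≤ gapTerm p η z t (i, k) := by
  have hφabs : ∀ y, |φ y| ≤ 1 := fun y => by
    rw [abs_of_nonneg (hφ0 y)]; exact (hφ y).trans (rightIndicator_le_one z y)
  have hu := fun y => continuous_oneP hp0 hp1 hη y
  have ha := fun y => (continuous_oneP hp0 hp1 hφabs y).comp (continuous_sub_left t)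
  have hw := fun y =>
    (continuous_oneP hp0 hp1 (abs_rightIndicator_le z) y).comp (continuous_sub_left t)
  rw [gapTerm, if_pos hi, ← intervalIntegral.integral_const_mul]
  refine intervalIntegral.integral_mono_on ht
    (((continuous_const.mul (((hu k).sub (hu (k + i))).pow 2)).mul
      ((ha k).mul (ha (k + i)))).intervalIntegrable 0 t)
    ((continuous_const.mul ((((hu k).sub (hu (k + i))).pow 2).mul
      ((hw (k + i)).pow 2))).intervalIntegrable 0 t) fun s hs => ?_
  have hts := sub_nonneg.mpr hs.2
  have haw := fun y => oneP_mono hp0 hp1 hφabs (abs_rightIndicator_le z) hφ hts y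
  have ha0 := fun y => oneP_nonneg hp0 hφ0 hts y
  rw [mul_assoc]
  refine mul_le_mul_of_nonneg_left (mul_le_mul_of_nonneg_left ?_ (sq_nonneg _)) (hp0 i)
  rw [sq]
  exact mul_le_mul ((haw k).trans (oneP_rightIndicator_mono hp0 hp1 hts z (by omega)))
    (haw _) (ha0 _) ((ha0 _).trans (haw _))

theorem integral_le_gapTerm_add (hp0 : ∀ i, 0 ≤ p i) (hsym : ∀ i, p (-i) = p i)
    (hp1 : HasSum p 1) (hη : ∀ k, |η k| ≤ 1) {φ : ℤ → ℝ} {z : ℝ} (hφ0 : ∀ y, 0 ≤ φ y)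
    (hφ : ∀ y, φ y ≤ rightIndicator z y) {t : ℝ} (ht : 0 ≤ t) (q : ℤ × ℤ) :
    ∫ s in (0 : ℝ)..t, p q.1 * (oneP p η s q.2 - oneP p η s (q.2 + q.1)) ^ 2 *
      (oneP p φ (t - s) q.2 * oneP p φ (t - s) (q.2 + q.1)) ≤
        gapTerm p η z t q + gapTerm p η z t (gapReflect q) := by
  obtain ⟨i, k⟩ := q
  have h1 := gapTerm_nonneg (η := η) hp0 z ht (i, k)
  have h2 := gapTerm_nonneg (η := η) hp0 z ht (gapReflect (i, k))
  rcases lt_trichotomy i 0 with hi | rfl | hi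
  · have := integral_le_gapTerm hp0 hp1 hη hφ0 hφ ht (i := -i) (by omega) (k + i)
    simp only [add_neg_cancel_right, hsym] at this
    refine le_trans (le_of_eq ?_) (this.trans (le_add_of_nonneg_left h1))
    exact intervalIntegral.integral_congr fun s _ => by ring
  · simpa using add_nonneg h1 h2
  · exact (integral_le_gapTerm hp0 hp1 hη hφ0 hφ ht (by omega) k).trans (le_add_of_nonneg_right h2)

theorem gapTerm_le (hp0 : ∀ i, 0 ≤ p i) (hp1 : HasSum p 1) (hη0 : ∀ k, 0 ≤ η k)
    (hη : ∀ k, |η k| ≤ 1) (z : ℝ) {t : ℝ} (ht : 0 ≤ t) {i : ℤ} (hi : 1 ≤ i) (k : ℤ) :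
    gapTerm p η z t (i, k) ≤
        ∫ s in (0 : ℝ)..t, p i * (oneP p η s k - oneP p η s (k + i)) ^ 2 ∧
      gapTerm p η z t (i, k) ≤ p i * (t * (Real.exp t * oneP p (rightIndicator z) t (k + i))) := by
  have hu := fun y => continuous_oneP hp0 hp1 hη y
  have hw := fun y =>
    (continuous_oneP hp0 hp1 (abs_rightIndicator_le z) y).comp (continuous_sub_left t)
  have hint : IntervalIntegrable (fun s => (oneP p η s k - oneP p η s (k + i)) ^ 2 *
      oneP p (rightIndicator z) (t - s) (k + i) ^ 2) volume 0 t :=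
    ((((hu k).sub (hu (k + i))).pow 2).mul ((hw (k + i)).pow 2)).intervalIntegrable 0 t
  have hu1 : ∀ s ∈ Set.Icc 0 t, (oneP p η s k - oneP p η s (k + i)) ^ 2 ≤ 1 := fun s hs => by
    have h1 := abs_le.mp (abs_oneP_le hp0 hp1 hη hs.1 k)
    have h2 := abs_le.mp (abs_oneP_le hp0 hp1 hη hs.1 (k + i))
    have h3 := oneP_nonneg hp0 hη0 hs.1 k
    have h4 := oneP_nonneg hp0 hη0 hs.1 (k + i)
    rw [sq_le_one_iff_abs_le_one, abs_le]
    constructor <;> linarith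
  have hw1 : ∀ s ∈ Set.Icc 0 t, oneP p (rightIndicator z) (t - s) (k + i) ^ 2 ≤
      oneP p (rightIndicator z) (t - s) (k + i) ∧
      oneP p (rightIndicator z) (t - s) (k + i) ≤ 1 := fun s hs => by
    have h1 := (abs_le.mp (abs_oneP_le hp0 hp1 (abs_rightIndicator_le z) (sub_nonneg.mpr hs.2)
      (k + i))).2
    have h2 := oneP_nonneg hp0 (rightIndicator_nonneg z) (sub_nonneg.mpr hs.2) (k + i)
    exact ⟨by nlinarith, h1⟩
  rw [gapTerm, if_pos hi, intervalIntegral.integral_const_mul]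
  constructor
  · refine mul_le_mul_of_nonneg_left (intervalIntegral.integral_mono_on ht hint
      ((((hu k).sub (hu (k + i))).pow 2).intervalIntegrable 0 t) fun s hs => ?_) (hp0 i)
    exact mul_le_of_le_one_right (sq_nonneg _) ((hw1 s hs).1.trans (hw1 s hs).2)
  · have hc : t * (Real.exp t * oneP p (rightIndicator z) t (k + i)) =
        ∫ _ in (0 : ℝ)..t, Real.exp t * oneP p (rightIndicator z) t (k + i) := by
      rw [intervalIntegral.integral_const, sub_zero, smul_eq_mul]
    rw [hc]
    refine mul_le_mul_of_nonneg_left (intervalIntegral.integral_mono_on ht hint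
      intervalIntegrable_const fun s hs => ?_) (hp0 i)
    exact (mul_le_of_le_one_left (sq_nonneg _) (hu1 s hs)).trans ((hw1 s hs).1.trans
      (oneP_le_of_le hp0 hp1 (rightIndicator_nonneg z) (abs_rightIndicator_le z)
        (sub_nonneg.mpr hs.2) (sub_le_self t hs.1) _))

theorem summable_gapTerm (hp0 : ∀ i, 0 ≤ p i) (hp1 : HasSum p 1) (hη0 : ∀ k, 0 ≤ η k)
    (hη : ∀ k, |η k| ≤ 1) {θ : ℝ} (hθ : 0 < θ)
    (hexp : Summable fun i : ℤ => Real.exp (θ * i) * p i) {G : ℝ → ℤ → ℤ → ℝ}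
    (hG : IsPairEvolution p (fun s j k => p (k - j) * (oneP p η s j - oneP p η s k) ^ 2) G)
    {z t : ℝ} (ht : 0 ≤ t) (hsum : Summable fun q : ℤ × ℤ =>
      G t q.1 q.2 * (rightIndicator z q.1 * rightIndicator z q.2)) :
    Summable (gapTerm p η z t) := by
  set C := t * (Real.exp t * ((∑' x : ℤ, Real.exp (θ * x) * ctPMF p t x) * Real.exp (-(θ * z))))
  have hM : ∀ k : ℤ, oneP p (rightIndicator z) t k ≤
      (∑' x : ℤ, Real.exp (θ * x) * ctPMF p t x) * Real.exp (-(θ * (z - k))) := fun k => by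
    rw [oneP_rightIndicator]
    exact ctTailGt_le_exp hp0 hθ.le hexp ht _
  have h1 := (pairOfGap.summable_iff.mpr hsum).mul_left (Real.exp (2 * t))
  have h2 := (hexp.mul_of_nonneg (summable_exp_halfLine hθ z)
    (fun i => mul_nonneg (Real.exp_pos _).le (hp0 i))
    (fun k => by simp only [Pi.zero_apply]; split_ifs <;> positivity)).mul_left C
  have hG0 := hG.nonneg hp0 hp1 ht
  have hC : 0 ≤ C := mul_nonneg ht (mul_nonneg (Real.exp_pos _).le (mul_nonneg
    (tsum_nonneg fun x => mul_nonneg (Real.exp_pos _).le (ctPMF_nonneg hp0 ht x))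
    (Real.exp_pos _).le))
  refine (h1.add h2).of_nonneg_of_le (fun q => gapTerm_nonneg hp0 z ht q) ?_
  rintro ⟨i, k⟩
  have h3 : 0 ≤ Real.exp (2 * t) * (G t k (k + i) * (rightIndicator z k * rightIndicator z (k + i)))
    := mul_nonneg (Real.exp_pos _).le (mul_nonneg (hG0 _ _)
      (mul_nonneg (rightIndicator_nonneg z _) (rightIndicator_nonneg z _)))
  have h4 : 0 ≤ C * (Real.exp (θ * i) * p i * if (k : ℝ) ≤ z then Real.exp (θ * k) else 0) :=
    mul_nonneg hC (mul_nonneg (mul_nonneg (Real.exp_pos _).le (hp0 i))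
      (by split_ifs <;> positivity))
  by_cases hi : 1 ≤ i
  · obtain ⟨h5, h6⟩ := gapTerm_le hp0 hp1 hη0 hη z ht hi k
    rcases lt_or_ge z (k : ℝ) with hk | hk
    · refine (h5.trans ?_).trans (le_add_of_nonneg_right h4)
      have h7 := hG.integral_source_le hp0 hp1 ht (j := k) (k := k + i) (by omega)
      have h8 : z < (k : ℝ) + i := hk.trans (by exact_mod_cast (by omega : k < k + i))
      simpa [pairOfGap, rightIndicator, if_pos hk, if_pos h8] using h7
    · refine (h6.trans ?_).trans (le_add_of_nonneg_left h3)
      rw [if_pos hk]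
      calc _ ≤ p i * (t * (Real.exp t * ((∑' x : ℤ, Real.exp (θ * x) * ctPMF p t x) *
            Real.exp (-(θ * (z - (k + i : ℤ))))))) := by
            have := hp0 i
            have := hM (k + i)
            gcongr
        _ = _ := by
            rw [show -(θ * (z - (k + i : ℤ))) = -(θ * z) + (θ * i + θ * k) by push_cast; ring,
              Real.exp_add, Real.exp_add]
            ring
  · rw [gapTerm, if_neg hi]
    exact add_nonneg h3 h4

theorem tsum_mul_rightIndicator_le (hp0 : ∀ i, 0 ≤ p i) (hsym : ∀ i, p (-i) = p i)
    (hp1 : HasSum p 1) (hη : ∀ k, |η k| ≤ 1) {G : ℝ → ℤ → ℤ → ℝ}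
    (hG : IsPairEvolution p (fun s j k => p (k - j) * (oneP p η s j - oneP p η s k) ^ 2) G)
    {z t : ℝ} (ht : 0 ≤ t) (hsum : Summable fun q : ℤ × ℤ =>
      G t q.1 q.2 * (rightIndicator z q.1 * rightIndicator z q.2))
    (hgap : Summable (gapTerm p η z t)) :
    ∑' q : ℤ × ℤ, G t q.1 q.2 * (rightIndicator z q.1 * rightIndicator z q.2) ≤
      2 * ∑' q : ℤ × ℤ, gapTerm p η z t q := by
  have hG0 := hG.nonneg hp0 hp1 ht
  refine hsum.tsum_le_of_sum_le fun T => ?_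
  set S := T.image Prod.fst ∪ T.image Prod.snd
  set φ : ℤ → ℝ := fun y => if y ∈ S then rightIndicator z y else 0
  have hφ0 : ∀ y, 0 ≤ φ y := fun y => by
    simp only [φ]; split_ifs <;> simp [rightIndicator_nonneg]
  have hφ : ∀ y, φ y ≤ rightIndicator z y := fun y => by
    simp only [φ]; split_ifs <;> simp [rightIndicator_nonneg]
  have hφS : ∀ y ∉ S, φ y = 0 := fun y hy => if_neg hy
  obtain ⟨hs, hle⟩ := hG.tsum_mul_le hp0 hsym hp1 hφ0
    (fun y => (hφ y).trans (rightIndicator_le_one z y)) S hφS ht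
  have hs' : Summable fun q : ℤ × ℤ => G t q.1 q.2 * (φ q.1 * φ q.2) :=
    hsum.of_nonneg_of_le (fun q => mul_nonneg (hG0 _ _) (mul_nonneg (hφ0 _) (hφ0 _))) fun q =>
      mul_le_mul_of_nonneg_left (mul_le_mul (hφ _) (hφ _) (hφ0 _) (rightIndicator_nonneg z _))
        (hG0 _ _)
  have hT : ∑ q ∈ T, G t q.1 q.2 * (rightIndicator z q.1 * rightIndicator z q.2) =
      ∑ q ∈ T, G t q.1 q.2 * (φ q.1 * φ q.2) := by
    refine Finset.sum_congr rfl fun q hq => ?_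
    have h1 : q.1 ∈ S := Finset.mem_union_left _ (Finset.mem_image_of_mem _ hq)
    have h2 : q.2 ∈ S := Finset.mem_union_right _ (Finset.mem_image_of_mem _ hq)
    simp only [φ, if_pos h1, if_pos h2]
  rw [hT]
  refine ((hs'.sum_le_tsum T fun q _ => mul_nonneg (hG0 _ _)
    (mul_nonneg (hφ0 _) (hφ0 _))).trans hle).trans ?_
  have hr := gapReflect.summable_iff.mpr hgap
  rw [← pairOfGap.tsum_eq]
  calc _ ≤ ∑' q, (gapTerm p η z t q + (gapTerm p η z t ∘ gapReflect) q) := by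
        refine (pairOfGap.summable_iff.mpr hs).tsum_le_tsum (fun q => ?_) (hgap.add hr)
        simpa [pairOfGap] using integral_le_gapTerm_add hp0 hsym hp1 hη hφ0 hφ ht q
    _ = _ := by
        rw [hgap.tsum_add hr, two_mul]
        congr 1
        exact gapReflect.tsum_eq _

end DualityBound

/-- Duality bound for the covariance sum in symmetric exclusion started from a
deterministic profile `η`.  Here `h t j k` is the two-point correlation function
`E_η[η_t(j)η_t(k)]`, characterized as the bounded solution of the Kolmogorov
equation for the two-particle exclusion generator with initial data `η j * η k`,
and `oneP p η t j = E_η[η_t(j)]` by one-particle duality.  The covariance sum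
`𝒞_t(η,z)` is bounded by the stated integral expression. -/
theorem stmt8 (p : ℤ → ℝ) (hp0 : ∀ i, 0 ≤ p i) (hsym : ∀ i, p (-i) = p i)
    (hsum : ∑' i : ℤ, p i = 1)
    (hirr : ∀ x : ℤ, ∃ n : ℕ, 0 < convPow p n x)
    (θ : ℝ) (hθ : 0 < θ)
    (hexp : Summable fun i : ℤ => Real.exp (θ * (i : ℝ)) * p i)
    (σ : ℝ) (hσ : 0 < σ) (hσ2 : σ ^ 2 = ∑' i : ℤ, (i : ℝ) ^ 2 * p i)
    (η : ℤ → ℝ) (hη : ∀ k, η k = 0 ∨ η k = 1)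
    (h : ℝ → ℤ → ℤ → ℝ)
    (h0 : ∀ j k : ℤ, j ≠ k → h 0 j k = η j * η k)
    (hbdd : ∀ (t : ℝ) (j k : ℤ), 0 ≤ h t j k ∧ h t j k ≤ 1)
    (hderiv : ∀ j k : ℤ, j ≠ k → ∀ t : ℝ, 0 ≤ t →
      HasDerivWithinAt (fun s => h s j k) (twoGen p (h t) j k) (Set.Ici 0) t)
    (t : ℝ) (ht : 0 ≤ t) (z : ℝ) :
    (∑' q : ℤ × ℤ, if q.1 ≠ q.2 ∧ z < (q.1 : ℝ) ∧ z < (q.2 : ℝ) then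
        oneP p η t q.1 * oneP p η t q.2 - h t q.1 q.2 else 0)
      ≤ 2 * ∑' i : ℤ, (if 1 ≤ i then
          p i * ∑' k : ℤ, ∫ s in (0:ℝ)..t,
            (oneP p η s k - oneP p η s (k + i)) ^ 2
              * (ctTailGt p (t - s) (z - ((k : ℝ) + (i : ℝ)))) ^ 2
        else 0) := by
  have hp1 : HasSum p 1 := by
    have : Summable p := by
      by_contra hn
      rw [tsum_eq_zero_of_not_summable hn] at hsum
      exact zero_ne_one hsum
    exact hsum ▸ this.hasSum
  have hη0 : ∀ k, 0 ≤ η k := fun k => by rcases hη k with hk | hk <;> simp [hk]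
  have hη1 : ∀ k, |η k| ≤ 1 := fun k => by rcases hη k with hk | hk <;> simp [hk]
  have hG := isPairEvolution_covariance hp0 hsym hp1 hη0 hη1 h0 hbdd hderiv
  have hL : ∀ q : ℤ × ℤ, (if q.1 ≠ q.2 ∧ z < (q.1 : ℝ) ∧ z < (q.2 : ℝ) then
        oneP p η t q.1 * oneP p η t q.2 - h t q.1 q.2 else 0) =
      offDiag (fun j k => oneP p η t j * oneP p η t k - h t j k) q.1 q.2 *
        (rightIndicator z q.1 * rightIndicator z q.2) := fun q => by
    by_cases h1 : q.1 = q.2 <;> by_cases h2 : z < (q.1 : ℝ) <;> by_cases h3 : z < (q.2 : ℝ) <;>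
      simp [offDiag, rightIndicator, h1, h2, h3]
  have hR : ∀ i : ℤ, (if 1 ≤ i then p i * ∑' k : ℤ, ∫ s in (0 : ℝ)..t,
        (oneP p η s k - oneP p η s (k + i)) ^ 2
          * (ctTailGt p (t - s) (z - ((k : ℝ) + (i : ℝ)))) ^ 2 else 0) =
      ∑' k : ℤ, gapTerm p η z t (i, k) := fun i => by
    by_cases hi : 1 ≤ i <;> simp [gapTerm, hi, tsum_mul_left, oneP_rightIndicator]
  simp only [hL, hR]
  by_cases hs : Summable fun q : ℤ × ℤ =>
      offDiag (fun j k => oneP p η t j * oneP p η t k - h t j k) q.1 q.2 *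
        (rightIndicator z q.1 * rightIndicator z q.2)
  · have hgap := summable_gapTerm hp0 hp1 hη0 hη1 hθ hexp hG ht hs
    rw [← hgap.tsum_prod]
    exact tsum_mul_rightIndicator_le hp0 hsym hp1 hη1 hG ht hs hgap
  · rw [tsum_eq_zero_of_not_summable hs]
    exact mul_nonneg zero_le_two (tsum_nonneg fun i => tsum_nonneg fun k =>
      gapTerm_nonneg hp0 z ht (i, k))
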